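/- arXiv:2306.15210 — 2 statements merged into one kernel-verified Lean document; each statement's English description precedes it below -/
import Mathlib

section
/- (Gagliardo–Nirenberg inequality for the inhomogeneous Hartree nonlinearity, bi-harmonic case.) Let N ≥ 5, 0 < α < N, and τ > 0 with 0 < 2τ < min{N + α, 4(1 + α/N)}. Let 1 + α/N < p < 1 + (4 − 2τ + α)/(N−4), and set B := (Np − N − α + 2τ)/2 and A := 2p − B. Then there exists a constant C > 0 such that for every smooth compactly supported u : ℝ^N → ℂ, P[u] ≤ C ‖u‖^A ‖Δu‖^B, where Δu is the Laplacian of u. -/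
open MeasureTheory

/-- The Laplacian of a function on `ℝ^N`. -/
noncomputable def lap {N : ℕ} {E : Type*} [NormedAddCommGroup E] [NormedSpace ℝ E]
    (u : EuclideanSpace ℝ (Fin N) → E) (x : EuclideanSpace ℝ (Fin N)) : E :=
  ∑ i, fderiv ℝ (fun y => fderiv ℝ u y (EuclideanSpace.single i 1)) x
    (EuclideanSpace.single i 1)

/-- The normalizing constant `c_{N,α}` of the Riesz potential. -/
noncomputable def rieszConst (N : ℕ) (α : ℝ) : ℝ :=
  Real.Gamma (((N : ℝ) - α) / 2) /
    (Real.Gamma (α / 2) * Real.pi ^ ((N : ℝ) / 2) * (2 : ℝ) ^ α)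

/-- Convolution `J_α ∗ g` of the Riesz potential with a real-valued function. -/
noncomputable def rieszConvR {N : ℕ} (α : ℝ) (g : EuclideanSpace ℝ (Fin N) → ℝ)
    (x : EuclideanSpace ℝ (Fin N)) : ℝ :=
  ∫ y, rieszConst N α * ‖x - y‖ ^ (α - (N : ℝ)) * g y

/-- The Hartree-type potential energy. -/
noncomputable def hartreeP {N : ℕ} (α τ p : ℝ) (u : EuclideanSpace ℝ (Fin N) → ℂ) : ℝ :=
  ∫ x, ‖x‖ ^ (-τ) * rieszConvR α (fun y => ‖y‖ ^ (-τ) * ‖u y‖ ^ p) x * ‖u x‖ ^ p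

/-- The `L²` norm. -/
noncomputable def l2norm {N : ℕ} (u : EuclideanSpace ℝ (Fin N) → ℂ) : ℝ :=
  (∫ x, ‖u x‖ ^ 2) ^ ((1 : ℝ) / 2)


open scoped ENNReal NNReal

lemma aux_tri (a b k : ℝ≥0∞) (q s : ℝ) (hq : 1 < q) (hs : 1 < s) (h : 2 / q + 1 / s = 2) :
    a * k * b ≤ a ^ q * b ^ q + a ^ q * k ^ s + b ^ q * k ^ s := by
  have hq0 : 0 < q := by linarith
  have hs0 : 0 < s := by linarith
  have hs1 : 0 ≤ 1 - 1 / s := by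
    have : 1 / s ≤ 1 := by rw [div_le_one hs0]; linarith
    linarith
  have hq1 : 0 ≤ 1 - 1 / q := by
    have : 1 / q ≤ 1 := by rw [div_le_one hq0]; linarith
    linarith
  have h' : 2 * (1 / q) + 1 / s = 2 := by
    have : 2 * (1 / q) = 2 / q := by ring
    linarith
  have e1 : q * (1 - 1 / s) + q * (1 - 1 / q) = 1 := by
    have : 1 / s = 2 - 2 * (1 / q) := by linarith
    rw [this]; field_simp; ring
  have e2 : s * (1 - 1 / q) + s * (1 - 1 / q) = 1 := by
    have : 1 / q = 1 - (1 / s) / 2 := by linarith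
    rw [this]; field_simp; ring
  set m := a ^ q * b ^ q + a ^ q * k ^ s + b ^ q * k ^ s with hm
  have key : a * k * b = (a ^ q * b ^ q) ^ (1 - 1 / s) * (a ^ q * k ^ s) ^ (1 - 1 / q)
      * (b ^ q * k ^ s) ^ (1 - 1 / q) := by
    simp only [ENNReal.mul_rpow_of_nonneg _ _ hs1, ENNReal.mul_rpow_of_nonneg _ _ hq1,
      ← ENNReal.rpow_mul]
    have ha : a ^ (q * (1 - 1 / s)) * a ^ (q * (1 - 1 / q)) = a := by
      rw [← ENNReal.rpow_add_of_nonneg _ _ (by positivity) (by positivity), e1, ENNReal.rpow_one]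
    have hb : b ^ (q * (1 - 1 / s)) * b ^ (q * (1 - 1 / q)) = b := by
      rw [← ENNReal.rpow_add_of_nonneg _ _ (by positivity) (by positivity), e1, ENNReal.rpow_one]
    have hk : k ^ (s * (1 - 1 / q)) * k ^ (s * (1 - 1 / q)) = k := by
      rw [← ENNReal.rpow_add_of_nonneg _ _ (by positivity) (by positivity), e2, ENNReal.rpow_one]
    calc a * k * b = (a ^ (q * (1 - 1 / s)) * a ^ (q * (1 - 1 / q))) *
          (k ^ (s * (1 - 1 / q)) * k ^ (s * (1 - 1 / q))) *
          (b ^ (q * (1 - 1 / s)) * b ^ (q * (1 - 1 / q))) := by rw [ha, hb, hk]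
      _ = _ := by ring
  have hmm : m = m ^ (1 - 1 / s) * m ^ (1 - 1 / q) * m ^ (1 - 1 / q) := by
    rw [← ENNReal.rpow_add_of_nonneg _ _ (by positivity) (by positivity),
      ← ENNReal.rpow_add_of_nonneg _ _ (by positivity) (by positivity)]
    have : 1 - 1 / s + (1 - 1 / q) + (1 - 1 / q) = 1 := by linarith
    rw [this, ENNReal.rpow_one]
  rw [key, hmm]
  have g1 : a ^ q * b ^ q ≤ m := by
    rw [hm, add_assoc]; exact le_self_add
  have g2 : a ^ q * k ^ s ≤ m := by
    rw [hm]; exact le_trans le_add_self le_self_add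
  have g3 : b ^ q * k ^ s ≤ m := by
    rw [hm]; exact le_add_self
  gcongr

lemma aux_two (a b : ℝ≥0∞) (θ : ℝ) (h0 : 0 < θ) (h1 : θ < 1) :
    a * b ≤ a ^ (1 / (1 - θ)) + b ^ (1 / θ) := by
  have h2 : 0 < 1 - θ := by linarith
  set m := a ^ (1 / (1 - θ)) + b ^ (1 / θ) with hm
  have key : a * b = (a ^ (1 / (1 - θ))) ^ (1 - θ) * (b ^ (1 / θ)) ^ θ := by
    rw [← ENNReal.rpow_mul, ← ENNReal.rpow_mul, one_div_mul_cancel h2.ne',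
      one_div_mul_cancel h0.ne', ENNReal.rpow_one, ENNReal.rpow_one]
  have hmm : m = m ^ (1 - θ) * m ^ θ := by
    rw [← ENNReal.rpow_add_of_nonneg _ _ h2.le h0.le]; simp
  rw [key, hmm]
  have g1 : a ^ (1 / (1 - θ)) ≤ m := le_self_add
  have g2 : b ^ (1 / θ) ≤ m := le_add_self
  gcongr

lemma aux_interp (g : ℝ≥0∞) (r a b : ℝ) (h1 : a ≤ r) (h2 : r ≤ b) : g ^ r ≤ g ^ a + g ^ b := by
  rcases le_total g 1 with h | h
  · exact (ENNReal.rpow_le_rpow_of_exponent_ge h h1).trans le_self_add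
  · exact (ENNReal.rpow_le_rpow_of_exponent_le h h2).trans le_add_self

lemma aux_young {N : ℕ} (f K : EuclideanSpace ℝ (Fin N) → ℝ≥0∞) (hf : Measurable f)
    (hK : Measurable K) (q s : ℝ) (hq : 1 < q) (hs : 1 < s) (h : 2 / q + 1 / s = 2) :
    ∫⁻ x, ∫⁻ y, f x * K (x - y) * f y ≤
      (∫⁻ x, f x ^ q) * (∫⁻ x, f x ^ q) + (∫⁻ x, f x ^ q) * (∫⁻ x, K x ^ s)
        + (∫⁻ x, f x ^ q) * (∫⁻ x, K x ^ s) := by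
  have hfq : Measurable fun x => f x ^ q := hf.pow_const _
  have hKs : Measurable fun x => K x ^ s := hK.pow_const _
  have m1 : Measurable fun z : EuclideanSpace ℝ (Fin N) × EuclideanSpace ℝ (Fin N) =>
      f z.2 ^ q * K (z.1 - z.2) ^ s :=
    (hfq.comp measurable_snd).mul (hKs.comp (measurable_fst.sub measurable_snd))
  have m2 : Measurable fun z : EuclideanSpace ℝ (Fin N) × EuclideanSpace ℝ (Fin N) =>
      f z.1 ^ q * K (z.1 - z.2) ^ s :=
    (hfq.comp measurable_fst).mul (hKs.comp (measurable_fst.sub measurable_snd))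
  have i1 : ∫⁻ x, ∫⁻ y, f x ^ q * f y ^ q = (∫⁻ x, f x ^ q) * (∫⁻ x, f x ^ q) := by
    simp_rw [lintegral_const_mul _ hfq]
    rw [lintegral_mul_const _ hfq]
  have i2 : ∫⁻ x, ∫⁻ y, f x ^ q * K (x - y) ^ s = (∫⁻ x, f x ^ q) * (∫⁻ x, K x ^ s) := by
    have : ∀ x, ∫⁻ y, f x ^ q * K (x - y) ^ s = f x ^ q * ∫⁻ y, K y ^ s := by
      intro x
      rw [lintegral_const_mul _
        (show Measurable fun y => K (x - y) ^ s from (hK.comp (measurable_const.sub measurable_id)).pow_const _)]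
      rw [lintegral_sub_left_eq_self (fun y => K y ^ s) x]
    simp_rw [this]
    rw [lintegral_mul_const _ hfq]
  have i3 : ∫⁻ x, ∫⁻ y, f y ^ q * K (x - y) ^ s = (∫⁻ x, f x ^ q) * (∫⁻ x, K x ^ s) := by
    rw [lintegral_lintegral_swap m1.aemeasurable]
    have : ∀ y, ∫⁻ x, f y ^ q * K (x - y) ^ s = f y ^ q * ∫⁻ y, K y ^ s := by
      intro x
      rw [lintegral_const_mul _
        (show Measurable fun y => K (y - x) ^ s from (hK.comp (measurable_id.sub measurable_const)).pow_const _)]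
      rw [lintegral_sub_right_eq_self (fun y => K y ^ s) x]
    simp_rw [this]
    rw [lintegral_mul_const _ hfq]
  calc ∫⁻ x, ∫⁻ y, f x * K (x - y) * f y
      ≤ ∫⁻ x, ∫⁻ y, (f x ^ q * f y ^ q + f x ^ q * K (x - y) ^ s + f y ^ q * K (x - y) ^ s) := by
        refine lintegral_mono fun x => lintegral_mono fun y => aux_tri _ _ _ q s hq hs h
    _ = _ := by
        rw [← i1]
        conv_rhs => rw [← i2]
        conv_rhs => arg 2; rw [i2, ← i3]
        have : ∀ x, ∫⁻ y, (f x ^ q * f y ^ q + f x ^ q * K (x - y) ^ s + f y ^ q * K (x - y) ^ s)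
          = (∫⁻ y, f x ^ q * f y ^ q) + (∫⁻ y, f x ^ q * K (x - y) ^ s)
            + ∫⁻ y, f y ^ q * K (x - y) ^ s := by
          intro x
          rw [lintegral_add_right _ (show Measurable fun y => f y ^ q * K (x - y) ^ s from
              m1.comp measurable_prodMk_left),
            lintegral_add_right _ (show Measurable fun y => f x ^ q * K (x - y) ^ s from
              m2.comp measurable_prodMk_left)]
        simp_rw [this]
        rw [lintegral_add_right _ m1.lintegral_prod_right', lintegral_add_right _ m2.lintegral_prod_right']

lemma aux_near {N : ℕ} (hN : 1 ≤ N) (t : ℝ) (ht : -(N : ℝ) < t) :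
    ∫⁻ x : EuclideanSpace ℝ (Fin N), ENNReal.ofReal ((Set.Iio (1 : ℝ)).indicator (fun r => r ^ t) ‖x‖) < ∞ := by
  have : Nonempty (Fin N) := ⟨⟨0, hN⟩⟩
  have h : Integrable (fun x : EuclideanSpace ℝ (Fin N) =>
      (Set.Iio (1 : ℝ)).indicator (fun r => r ^ t) ‖x‖) := by
    rw [integrable_fun_norm_addHaar volume (f := (Set.Iio (1 : ℝ)).indicator (fun r => r ^ t))]
    have h1 : IntegrableOn (fun r : ℝ => r ^ ((N : ℝ) - 1 + t)) (Set.Ioo 0 1) := by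
      rw [intervalIntegral.integrableOn_Ioo_rpow_iff one_pos]; linarith
    rw [← integrable_indicator_iff measurableSet_Ioo] at h1
    rw [← integrable_indicator_iff measurableSet_Ioi]
    convert h1 using 1
    ext r
    by_cases h0 : 0 < r <;> by_cases h2 : r < 1 <;> simp [Set.indicator, h0, h2]
    rw [Real.rpow_add h0, ← Real.rpow_natCast, Nat.cast_sub hN]; simp
  exact h.lintegral_lt_top

lemma aux_far {N : ℕ} (hN : 1 ≤ N) (t : ℝ) (ht : t < -(N : ℝ)) :
    ∫⁻ x : EuclideanSpace ℝ (Fin N), ENNReal.ofReal ((Set.Ici (1 : ℝ)).indicator (fun r => r ^ t) ‖x‖) < ∞ := by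
  have : Nonempty (Fin N) := ⟨⟨0, hN⟩⟩
  have h : Integrable (fun x : EuclideanSpace ℝ (Fin N) =>
      (Set.Ici (1 : ℝ)).indicator (fun r => r ^ t) ‖x‖) := by
    rw [integrable_fun_norm_addHaar volume (f := (Set.Ici (1 : ℝ)).indicator (fun r => r ^ t))]
    have h1 : IntegrableOn (fun r : ℝ => r ^ ((N : ℝ) - 1 + t)) (Set.Ici 1) := by
      rw [integrableOn_Ici_iff_integrableOn_Ioi, integrableOn_Ioi_rpow_iff one_pos]; linarith
    rw [← integrable_indicator_iff measurableSet_Ici] at h1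
    rw [← integrable_indicator_iff measurableSet_Ioi]
    convert h1 using 1
    ext r
    by_cases h2 : 1 ≤ r
    · have h0 : 0 < r := by linarith
      simp [Set.indicator, h0, h2]
      rw [Real.rpow_add h0, ← Real.rpow_natCast, Nat.cast_sub hN]; simp
    · simp [Set.indicator, h2]
  exact h.lintegral_lt_top


/-- Partial derivative in the direction of the `i`-th basis vector. -/
noncomputable def pd {N : ℕ} (i : Fin N) (u : EuclideanSpace ℝ (Fin N) → ℂ)
    (x : EuclideanSpace ℝ (Fin N)) : ℂ := fderiv ℝ u x (EuclideanSpace.single i 1)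

lemma pd_smooth {N : ℕ} (i : Fin N) {u : EuclideanSpace ℝ (Fin N) → ℂ}
    (hu : ContDiff ℝ (⊤ : ℕ∞) u) : ContDiff ℝ (⊤ : ℕ∞) (pd i u) := by
  have := (contDiff_infty_iff_fderiv.1 hu).2
  exact this.clm_apply contDiff_const

lemma pd_supp {N : ℕ} (i : Fin N) {u : EuclideanSpace ℝ (Fin N) → ℂ}
    (hu : HasCompactSupport u) : HasCompactSupport (pd i u) := hu.fderiv_apply ℝ _

lemma pd_comm {N : ℕ} (i j : Fin N) {u : EuclideanSpace ℝ (Fin N) → ℂ}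
    (hu : ContDiff ℝ (⊤ : ℕ∞) u) : pd i (pd j u) = pd j (pd i u) := by
  have hd : Differentiable ℝ (fderiv ℝ u) :=
    ((contDiff_infty_iff_fderiv.1 hu).2).differentiable (by simp)
  have key : ∀ (i j : Fin N) x, pd i (pd j u) x =
      fderiv ℝ (fderiv ℝ u) x (EuclideanSpace.single i 1) (EuclideanSpace.single j 1) := by
    intro i j x
    have := ((hd x).hasFDerivAt.clm_apply
      (hasFDerivAt_const (EuclideanSpace.single j (1:ℝ)) x)).fderiv
    have e : pd j u = fun y => fderiv ℝ u y (EuclideanSpace.single j 1) := rfl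
    rw [pd, e, this]
    simp
  ext x
  rw [key, key]
  have hs : IsSymmSndFDerivAt ℝ u x := by
    refine ContDiffAt.isSymmSndFDerivAt hu.contDiffAt ?_
    simp only [minSmoothness_of_isRCLikeNormedField]
    exact WithTop.coe_le_coe.2 (le_top : (2 : ℕ∞) ≤ ⊤)
  exact hs _ _

lemma pd_ibp {N : ℕ} (i : Fin N) {f g : EuclideanSpace ℝ (Fin N) → ℂ}
    (hf : ContDiff ℝ (⊤ : ℕ∞) f) (hg : ContDiff ℝ (⊤ : ℕ∞) g) (h : HasCompactSupport f) :
    ∫ x, inner ℝ (f x) (pd i g x) = - ∫ x, inner ℝ (pd i f x) (g x) := by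
  have c1 : Integrable fun x => inner ℝ (f x) (pd i g x) :=
    (hf.continuous.inner (𝕜 := ℝ) (pd_smooth i hg).continuous).integrable_of_hasCompactSupport
      (h.mono fun x hx => by
        simp only [Function.mem_support] at hx ⊢; contrapose! hx; simp [hx])
  have c2 : Integrable fun x => inner ℝ (pd i f x) (g x) :=
    ((pd_smooth i hf).continuous.inner (𝕜 := ℝ) hg.continuous).integrable_of_hasCompactSupport
      ((pd_supp i h).mono fun x hx => by
        simp only [Function.mem_support] at hx ⊢; contrapose! hx; simp [hx])
  have c3 : Integrable fun x => inner ℝ (f x) (g x) :=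
    (hf.continuous.inner (𝕜 := ℝ) hg.continuous).integrable_of_hasCompactSupport
      (h.mono fun x hx => by
        simp only [Function.mem_support] at hx ⊢; contrapose! hx; simp [hx])
  exact integral_bilinear_fderiv_right_eq_neg_left_of_integrable (B := innerSL ℝ) (μ := volume)
    (f := f) (g := g) (v := EuclideanSpace.single i 1) c2 c1 c3
    (fun x _ => hf.differentiable (by simp) x) (fun x _ => hg.differentiable (by simp) x)

lemma hess_eq {N : ℕ} (i j : Fin N) {u : EuclideanSpace ℝ (Fin N) → ℂ}
    (hu : ContDiff ℝ (⊤ : ℕ∞) u) (h : HasCompactSupport u) :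
    ∫ x, inner ℝ (pd i (pd i u) x) (pd j (pd j u) x) = ∫ x, ‖pd i (pd j u) x‖ ^ 2 := by
  have s1 := pd_smooth i hu
  have s2 := pd_smooth j hu
  have h1 := pd_ibp i (pd_smooth i s1) (pd_smooth i s2) (pd_supp i (pd_supp i h))
  rw [pd_ibp j (pd_smooth i s1) s2 (pd_supp i (pd_supp i h))]
  rw [pd_comm j i s1, pd_comm j i hu]
  have := pd_ibp i (pd_smooth i s2) s2 (pd_supp i (pd_supp j h))
  rw [← this]
  simp

lemma lap_eq {N : ℕ} (u : EuclideanSpace ℝ (Fin N) → ℂ) (x) :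
    lap u x = ∑ i, pd i (pd i u) x := rfl

lemma hess_le {N : ℕ} (i j : Fin N) {u : EuclideanSpace ℝ (Fin N) → ℂ}
    (hu : ContDiff ℝ (⊤ : ℕ∞) u) (h : HasCompactSupport u) :
    ∫ x, ‖pd i (pd j u) x‖ ^ 2 ≤ ∫ x, ‖lap u x‖ ^ 2 := by
  have hint : ∀ i j, Integrable fun x => inner ℝ (pd i (pd i u) x) (pd j (pd j u) x) := fun i j =>
    ((pd_smooth i (pd_smooth i hu)).continuous.inner (𝕜 := ℝ)
      (pd_smooth j (pd_smooth j hu)).continuous).integrable_of_hasCompactSupport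
      ((pd_supp i (pd_supp i h)).mono fun x hx => by
        simp only [Function.mem_support] at hx ⊢; contrapose! hx; simp [hx])
  have e : ∫ x, ‖lap u x‖ ^ 2 = ∑ i, ∑ j, ∫ x, ‖pd i (pd j u) x‖ ^ 2 := by
    simp_rw [← hess_eq _ _ hu h]
    have : ∀ x, ‖lap u x‖ ^ 2 = ∑ i, ∑ j, inner ℝ (pd i (pd i u) x) (pd j (pd j u) x) := by
      intro x
      rw [← real_inner_self_eq_norm_sq, lap_eq, sum_inner]
      simp_rw [inner_sum]
    simp_rw [this]
    rw [integral_finsetSum _ (fun i _ => integrable_finsetSum _ fun j _ => hint i j)]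
    refine Finset.sum_congr rfl fun i _ => ?_
    rw [integral_finsetSum _ (fun j _ => hint i j)]
  rw [e]
  have nn : ∀ i j, 0 ≤ ∫ x, ‖pd i (pd j u) x‖ ^ 2 := fun i j => integral_nonneg fun x => by positivity
  exact (Finset.single_le_sum (f := fun j => ∫ x, ‖pd i (pd j u) x‖ ^ 2)
    (fun j _ => nn i j) (Finset.mem_univ j)).trans
    (Finset.single_le_sum (f := fun i => ∑ j, ∫ x, ‖pd i (pd j u) x‖ ^ 2)
    (fun i _ => Finset.sum_nonneg fun j _ => nn i j) (Finset.mem_univ i))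

lemma lap_smooth {N : ℕ} {u : EuclideanSpace ℝ (Fin N) → ℂ}
    (hu : ContDiff ℝ (⊤ : ℕ∞) u) : ContDiff ℝ (⊤ : ℕ∞) (lap u) := by
  have : lap u = fun x => ∑ i, pd i (pd i u) x := rfl
  rw [this]
  exact ContDiff.sum fun i _ => pd_smooth i (pd_smooth i hu)

lemma lap_supp {N : ℕ} {u : EuclideanSpace ℝ (Fin N) → ℂ}
    (h : HasCompactSupport u) : HasCompactSupport (lap u) := by
  refine HasCompactSupport.of_support_subset_isCompact (K := tsupport u) h ?_
  intro x hx
  contrapose! hx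
  simp only [Function.mem_support, not_not]
  rw [lap_eq]
  refine Finset.sum_eq_zero fun i _ => ?_
  have h1 : tsupport (pd i u) ⊆ tsupport u := tsupport_fderiv_apply_subset ℝ _
  have h2 : tsupport (pd i (pd i u)) ⊆ tsupport (pd i u) := tsupport_fderiv_apply_subset ℝ _
  exact image_eq_zero_of_notMem_tsupport fun hh => hx (h1 (h2 hh))

lemma lint_sq {N : ℕ} {u : EuclideanSpace ℝ (Fin N) → ℂ} (hu : Continuous u)
    (h : HasCompactSupport u) :
    ∫⁻ x, ‖u x‖ₑ ^ (2 : ℝ) = ENNReal.ofReal (∫ x, ‖u x‖ ^ 2) := by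
  rw [ofReal_integral_eq_lintegral_ofReal]
  · refine lintegral_congr fun x => ?_
    rw [← ofReal_norm, ENNReal.ofReal_pow (norm_nonneg _)]
    exact ENNReal.rpow_natCast _ 2
  · refine (hu.norm.pow 2).integrable_of_hasCompactSupport (h.mono fun x hx => by
        simp only [Function.mem_support] at hx ⊢; contrapose! hx; simp [hx])
  · exact Filter.Eventually.of_forall fun x => by positivity

lemma eLp_two {N : ℕ} {u : EuclideanSpace ℝ (Fin N) → ℂ} (hu : Continuous u)
    (h : HasCompactSupport u) : eLpNorm u 2 volume = ENNReal.ofReal (l2norm u) := by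
  rw [eLpNorm_eq_lintegral_rpow_enorm_toReal (by simp) (by simp), ENNReal.toReal_ofNat,
    lint_sq hu h, l2norm, ENNReal.ofReal_rpow_of_nonneg (integral_nonneg fun x => by positivity)
    (by norm_num)]

lemma fderiv_le {N : ℕ} (u : EuclideanSpace ℝ (Fin N) → ℂ) (x) :
    ‖fderiv ℝ u x‖ ≤ ∑ i, ‖pd i u x‖ := by
  refine ContinuousLinearMap.opNorm_le_bound _ (by positivity) fun v => ?_
  have hv : v = ∑ i, v i • EuclideanSpace.single i (1:ℝ) := by
    ext j; simp [Finset.sum_apply, Pi.single_apply]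
  conv_lhs => rw [hv]
  rw [map_sum, Finset.sum_mul]
  refine (norm_sum_le _ _).trans (Finset.sum_le_sum fun i _ => ?_)
  rw [map_smul, norm_smul, mul_comm]
  exact mul_le_mul_of_nonneg_left (PiLp.norm_apply_le v i) (norm_nonneg _)

lemma eLp_fderiv_le {N : ℕ} {u : EuclideanSpace ℝ (Fin N) → ℂ}
    (hu : ContDiff ℝ (⊤ : ℕ∞) u) (p : ℝ≥0∞) (hp : 1 ≤ p) :
    eLpNorm (fderiv ℝ u) p volume ≤ ∑ i, eLpNorm (pd i u) p volume := by
  calc eLpNorm (fderiv ℝ u) p volume ≤ eLpNorm (∑ i, fun x => ‖pd i u x‖) p volume := by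
        refine eLpNorm_mono_real fun x => ?_
        simpa using fderiv_le u x
    _ ≤ ∑ i, eLpNorm (fun x => ‖pd i u x‖) p volume :=
        eLpNorm_sum_le (fun i _ => (pd_smooth i hu).continuous.norm.aestronglyMeasurable) hp
    _ = _ := by simp_rw [eLpNorm_norm]

lemma sobolev {N : ℕ} (hN : 5 ≤ N) : ∃ C : ℝ≥0, ∀ u : EuclideanSpace ℝ (Fin N) → ℂ,
      ContDiff ℝ (⊤ : ℕ∞) u → HasCompactSupport u →
      eLpNorm u ((2 * N / (N - 4) : ℝ≥0) : ℝ≥0∞) volume ≤ C * ENNReal.ofReal (l2norm (lap u)) := by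
  have hN' : (5 : ℝ) ≤ N := by exact_mod_cast hN
  have c4 : ((N - 4 : ℝ≥0) : ℝ) = (N : ℝ) - 4 := by
    rw [NNReal.coe_sub (by rw [← NNReal.coe_le_coe]; push_cast; linarith)]; simp
  have c2 : ((N - 2 : ℝ≥0) : ℝ) = (N : ℝ) - 2 := by
    rw [NNReal.coe_sub (by rw [← NNReal.coe_le_coe]; push_cast; linarith)]; simp
  let r : ℝ≥0 := 2 * N / (N - 2)
  have hr : (r : ℝ) = 2 * N / (N - 2) := by simp [r, c2]
  have hr1 : 1 ≤ r := by
    rw [← NNReal.coe_le_coe, hr, NNReal.coe_one, le_div_iff₀] <;> linarith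
  have hfr : Module.finrank ℝ (EuclideanSpace ℝ (Fin N)) = N := by simp
  let C1 : ℝ≥0 := SNormLESNormFDerivOfEqConst ℂ (volume : Measure (EuclideanSpace ℝ (Fin N))) r
  let C2 : ℝ≥0 := SNormLESNormFDerivOfEqConst ℂ (volume : Measure (EuclideanSpace ℝ (Fin N))) (2 : ℝ≥0)
  refine ⟨C1 * (N * (C2 * N)), fun u hu h => ?_⟩
  have g1 : eLpNorm u ((2 * N / (N - 4) : ℝ≥0) : ℝ≥0∞) volume ≤ C1 * eLpNorm (fderiv ℝ u) r volume := by
    refine eLpNorm_le_eLpNorm_fderiv_of_eq volume (hu.of_le (by simp)) h hr1 (by rw [hfr]; omega) ?_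
    rw [hfr, NNReal.coe_inv, hr, NNReal.coe_div, c4]
    push_cast
    have : (N : ℝ) - 4 ≠ 0 := by linarith
    have : (N : ℝ) - 2 ≠ 0 := by linarith
    field_simp
    ring
  have g2 : ∀ i, eLpNorm (pd i u) r volume ≤ C2 * eLpNorm (fderiv ℝ (pd i u)) (2 : ℝ≥0) volume := by
    intro i
    refine eLpNorm_le_eLpNorm_fderiv_of_eq volume ((pd_smooth i hu).of_le (by simp)) (pd_supp i h) (by norm_num) (by rw [hfr]; omega) ?_
    rw [hfr, hr]
    push_cast
    have : (N : ℝ) - 2 ≠ 0 := by linarith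
    field_simp
  have g3 : ∀ i j, eLpNorm (pd i (pd j u)) (2 : ℝ≥0) volume ≤ ENNReal.ofReal (l2norm (lap u)) := by
    intro i j
    have := eLp_two (pd_smooth i (pd_smooth j hu)).continuous (pd_supp i (pd_supp j h))
    rw [ENNReal.coe_ofNat, this]
    refine ENNReal.ofReal_le_ofReal ?_
    exact Real.rpow_le_rpow (integral_nonneg fun x => by positivity) (hess_le i j hu h) (by norm_num)
  have g4 : ∀ i, eLpNorm (fderiv ℝ (pd i u)) (2 : ℝ≥0) volume ≤ N * ENNReal.ofReal (l2norm (lap u)) := by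
    intro i
    refine (eLp_fderiv_le (pd_smooth i hu) _ (by norm_num)).trans ?_
    refine (Finset.sum_le_sum fun j _ => g3 j i).trans ?_
    simp
  calc _ ≤ C1 * eLpNorm (fderiv ℝ u) r volume := g1
    _ ≤ C1 * ∑ i, eLpNorm (pd i u) r volume := by
        gcongr
        exact eLp_fderiv_le hu _ (by exact_mod_cast hr1)
    _ ≤ C1 * ∑ i : Fin N, C2 * (N * ENNReal.ofReal (l2norm (lap u))) := by
        gcongr with i
        exact (g2 i).trans (by gcongr; exact g4 i)
    _ = _ := by simp; ring

lemma weight_bound {N : ℕ} (hN : 5 ≤ N) (τ p q : ℝ) (hτ : 0 < τ) (hp : 0 < p)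
    (hq1 : 1 < q) (hpq : 2 < p * q) (hq : q * (2 * τ + p * ((N : ℝ) - 4)) < 2 * N) (S : ℝ≥0∞)
    (hS : S < ∞) : ∃ M : ℝ≥0∞, M < ∞ ∧ ∀ g : EuclideanSpace ℝ (Fin N) → ℝ≥0∞, Measurable g →
      (∫⁻ x, g x ^ (2 : ℝ)) ≤ 1 → (∫⁻ x, g x ^ (2 * N / (N - 4) : ℝ)) ≤ S →
      ∫⁻ x, (ENNReal.ofReal (‖x‖ ^ (-τ)) * g x ^ p) ^ q ≤ M := by
  have hN' : (5 : ℝ) ≤ N := by exact_mod_cast hN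
  have hN4 : 0 < (N : ℝ) - 4 := by linarith
  set θ : ℝ := p * q * (N - 4) / (2 * N) with hθ
  have h0 : 0 < θ := by positivity
  have hθ' : θ * (2 * N) = p * q * (N - 4) := by rw [hθ]; field_simp
  have hτq : 0 < q * τ := by positivity
  have h1 : θ < 1 := by
    have : θ * (2 * N) < 1 * (2 * N) := by rw [hθ']; nlinarith
    exact lt_of_mul_lt_mul_right this (by positivity)
  have hr : p * q * (1 / θ) = 2 * N / (N - 4) := by rw [hθ]; field_simp
  have hr2 : p * q ≤ 2 * N / (N - 4) := by
    rw [le_div_iff₀ hN4]; nlinarith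
  set t : ℝ := -τ * (q * (1 / (1 - θ))) with ht
  have h1θ : 0 < 1 - θ := by linarith
  have ht' : -(N : ℝ) < t := by
    rw [ht]
    have : τ * (q * (1 / (1 - θ))) < N := by
      rw [← mul_assoc, mul_one_div, div_lt_iff₀ h1θ]
      nlinarith
    linarith
  have hnear := aux_near (N := N) (by omega) t ht'
  set I := ∫⁻ x : EuclideanSpace ℝ (Fin N),
    ENNReal.ofReal ((Set.Iio (1 : ℝ)).indicator (fun r => r ^ t) ‖x‖) with hI
  refine ⟨(1 + S) + (I + S), by simp [hS, hnear], fun g hg hg2 hgS => ?_⟩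
  have pw : ∀ x : EuclideanSpace ℝ (Fin N), (ENNReal.ofReal (‖x‖ ^ (-τ)) * g x ^ p) ^ q ≤
      (g x ^ (2 : ℝ) + g x ^ (2 * N / (N - 4) : ℝ)) +
      (ENNReal.ofReal ((Set.Iio (1 : ℝ)).indicator (fun r => r ^ t) ‖x‖)
        + g x ^ (2 * N / (N - 4) : ℝ)) := by
    intro x
    rw [ENNReal.mul_rpow_of_nonneg _ _ (by linarith), ← ENNReal.rpow_mul]
    by_cases hx : ‖x‖ < 1
    · refine le_trans ?_ le_add_self
      refine (aux_two _ _ θ h0 h1).trans ?_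
      rw [← ENNReal.rpow_mul, ← ENNReal.rpow_mul, hr,
        ENNReal.ofReal_rpow_of_nonneg (by positivity) (by positivity),
        ← Real.rpow_mul (norm_nonneg _), ← ht]
      simp [Set.indicator, hx]
    · refine le_trans ?_ le_self_add
      refine le_trans ?_ (aux_interp (g x) (p * q) 2 (2 * N / (N - 4)) hpq.le hr2)
      have hw : ENNReal.ofReal (‖x‖ ^ (-τ)) ≤ 1 := by
        rw [ENNReal.ofReal_le_one]
        exact Real.rpow_le_one_of_one_le_of_nonpos (not_lt.1 hx) (by linarith)
      have : ENNReal.ofReal (‖x‖ ^ (-τ)) ^ q ≤ 1 := ENNReal.rpow_le_one hw (by linarith)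
      calc _ ≤ 1 * g x ^ (p * q) := by gcongr
        _ = _ := one_mul _
  refine (lintegral_mono pw).trans ?_
  rw [lintegral_add_left (show Measurable fun x => g x ^ (2 : ℝ) + g x ^ (2 * N / (N - 4) : ℝ) from
    (hg.pow_const _).add (hg.pow_const _)), lintegral_add_left (hg.pow_const _),
    lintegral_add_right _ (hg.pow_const _)]
  gcongr

lemma kernel_split {N : ℕ} (f : EuclideanSpace ℝ (Fin N) → ℝ≥0∞) (hf : Measurable f) (t : ℝ)
    (q₁ q₂ s₁ s₂ : ℝ) (hq1 : 1 < q₁) (hq2 : 1 < q₂) (hs1 : 1 < s₁) (hs2 : 1 < s₂)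
    (h1 : 2 / q₁ + 1 / s₁ = 2) (h2 : 2 / q₂ + 1 / s₂ = 2) (M₁ M₂ : ℝ≥0∞)
    (hM1 : ∫⁻ x, f x ^ q₁ ≤ M₁) (hM2 : ∫⁻ x, f x ^ q₂ ≤ M₂) :
    ∫⁻ x, ∫⁻ y, f x * ENNReal.ofReal (‖x - y‖ ^ t) * f y ≤
     (M₁ * M₁ + M₁ * (∫⁻ x : EuclideanSpace ℝ (Fin N),
        ENNReal.ofReal ((Set.Iio (1 : ℝ)).indicator (fun r => r ^ (t * s₁)) ‖x‖)) +
      M₁ * (∫⁻ x : EuclideanSpace ℝ (Fin N),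
        ENNReal.ofReal ((Set.Iio (1 : ℝ)).indicator (fun r => r ^ (t * s₁)) ‖x‖))) +
     (M₂ * M₂ + M₂ * (∫⁻ x : EuclideanSpace ℝ (Fin N),
        ENNReal.ofReal ((Set.Ici (1 : ℝ)).indicator (fun r => r ^ (t * s₂)) ‖x‖)) +
      M₂ * (∫⁻ x : EuclideanSpace ℝ (Fin N),
        ENNReal.ofReal ((Set.Ici (1 : ℝ)).indicator (fun r => r ^ (t * s₂)) ‖x‖))) := by
  let K1 : EuclideanSpace ℝ (Fin N) → ℝ≥0∞ := fun x =>
    ENNReal.ofReal ((Set.Iio (1 : ℝ)).indicator (fun r => r ^ t) ‖x‖)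
  let K2 : EuclideanSpace ℝ (Fin N) → ℝ≥0∞ := fun x =>
    ENNReal.ofReal ((Set.Ici (1 : ℝ)).indicator (fun r => r ^ t) ‖x‖)
  have hK1 : Measurable K1 :=
    (((measurable_id.pow_const t).indicator measurableSet_Iio).comp measurable_norm).ennreal_ofReal
  have hK2 : Measurable K2 :=
    (((measurable_id.pow_const t).indicator measurableSet_Ici).comp measurable_norm).ennreal_ofReal
  have e1 : ∀ x, K1 x ^ s₁ =
      ENNReal.ofReal ((Set.Iio (1 : ℝ)).indicator (fun r => r ^ (t * s₁)) ‖x‖) := by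
    intro x
    by_cases hx : ‖x‖ < 1
    · simp only [K1, Set.indicator, Set.mem_Iio, hx, if_true]
      rw [ENNReal.ofReal_rpow_of_nonneg (by positivity) (by linarith),
        ← Real.rpow_mul (norm_nonneg _)]
    · simp [K1, Set.indicator, hx]; linarith
  have e2 : ∀ x, K2 x ^ s₂ =
      ENNReal.ofReal ((Set.Ici (1 : ℝ)).indicator (fun r => r ^ (t * s₂)) ‖x‖) := by
    intro x
    by_cases hx : 1 ≤ ‖x‖
    · simp only [K2, Set.indicator, Set.mem_Ici, hx, if_true]
      rw [ENNReal.ofReal_rpow_of_nonneg (by positivity) (by linarith),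
        ← Real.rpow_mul (norm_nonneg _)]
    · simp [K2, Set.indicator, hx]; linarith
  have y1 := aux_young f K1 hf hK1 q₁ s₁ hq1 hs1 h1
  have y2 := aux_young f K2 hf hK2 q₂ s₂ hq2 hs2 h2
  simp_rw [e1] at y1
  simp_rw [e2] at y2
  have m1 : Measurable fun z : EuclideanSpace ℝ (Fin N) × EuclideanSpace ℝ (Fin N) =>
      f z.1 * K1 (z.1 - z.2) * f z.2 :=
    ((hf.comp measurable_fst).mul (hK1.comp (measurable_fst.sub measurable_snd))).mul
      (hf.comp measurable_snd)
  have sp : ∫⁻ x, ∫⁻ y, f x * ENNReal.ofReal (‖x - y‖ ^ t) * f y ≤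
      (∫⁻ x, ∫⁻ y, f x * K1 (x - y) * f y) + ∫⁻ x, ∫⁻ y, f x * K2 (x - y) * f y := by
    rw [← lintegral_add_left m1.lintegral_prod_right']
    refine lintegral_mono fun x => ?_
    rw [← lintegral_add_left (show Measurable fun y => f x * K1 (x - y) * f y from
      m1.comp measurable_prodMk_left)]
    refine lintegral_mono fun y => ?_
    rw [← add_mul, ← mul_add]
    gcongr
    by_cases hx : ‖x - y‖ < 1
    · simp [K1, Set.indicator, hx]
    · simp [K2, Set.indicator, not_lt.1 hx]
  refine sp.trans ((add_le_add y1 y2).trans ?_)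
  gcongr

lemma hartree_le {N : ℕ} (α τ p : ℝ) (u : EuclideanSpace ℝ (Fin N) → ℂ) (hp : 0 < p) :
    ENNReal.ofReal (hartreeP α τ p u) ≤ ENNReal.ofReal |rieszConst N α| *
      ∫⁻ x, ∫⁻ y, (ENNReal.ofReal (‖x‖ ^ (-τ)) * ‖u x‖ₑ ^ p) *
        ENNReal.ofReal (‖x - y‖ ^ (α - (N : ℝ))) * (ENNReal.ofReal (‖y‖ ^ (-τ)) * ‖u y‖ₑ ^ p) := by
  have en : ∀ x, ‖‖x‖ ^ (-τ) * ‖u x‖ ^ p‖ₑ = ENNReal.ofReal (‖x‖ ^ (-τ)) * ‖u x‖ₑ ^ p := by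
    intro x
    rw [← ofReal_norm, Real.norm_of_nonneg (by positivity), ENNReal.ofReal_mul (by positivity),
      ← ENNReal.ofReal_rpow_of_nonneg (norm_nonneg _) hp.le, ofReal_norm]
  have h1 : ENNReal.ofReal (hartreeP α τ p u) ≤ ‖hartreeP α τ p u‖ₑ := by
    rw [← ofReal_norm]; exact ENNReal.ofReal_le_ofReal (le_abs_self _)
  refine h1.trans ((enorm_integral_le_lintegral_enorm _).trans ?_)
  rw [← lintegral_const_mul' _ _ ENNReal.ofReal_ne_top]
  refine lintegral_mono fun x => ?_
  have : ‖x‖ ^ (-τ) * rieszConvR α (fun y => ‖y‖ ^ (-τ) * ‖u y‖ ^ p) x * ‖u x‖ ^ p =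
    (‖x‖ ^ (-τ) * ‖u x‖ ^ p) * rieszConvR α (fun y => ‖y‖ ^ (-τ) * ‖u y‖ ^ p) x := by ring
  rw [this, enorm_mul, en]
  have fin : ENNReal.ofReal (‖x‖ ^ (-τ)) * ‖u x‖ₑ ^ p ≠ ∞ :=
    ENNReal.mul_ne_top ENNReal.ofReal_ne_top (ENNReal.rpow_ne_top_of_nonneg hp.le enorm_ne_top)
  calc _ ≤ ENNReal.ofReal (‖x‖ ^ (-τ)) * ‖u x‖ₑ ^ p *
      ∫⁻ y, ‖rieszConst N α * ‖x - y‖ ^ (α - (N : ℝ)) * (‖y‖ ^ (-τ) * ‖u y‖ ^ p)‖ₑ := by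
        gcongr
        exact enorm_integral_le_lintegral_enorm _
    _ = _ := by
        rw [← lintegral_const_mul' _ _ fin, ← lintegral_const_mul' _ _ ENNReal.ofReal_ne_top]
        refine lintegral_congr fun y => ?_
        rw [enorm_mul, enorm_mul, en, ← ofReal_norm (rieszConst N α), Real.norm_eq_abs,
          ← ofReal_norm (‖x - y‖ ^ (α - (N : ℝ))), Real.norm_of_nonneg (by positivity)]
        ring

lemma normalized {N : ℕ} (hN : 5 ≤ N) (α τ p : ℝ)
    (hα : 0 < α) (hαN : α < N) (hτ : 0 < τ)
    (hp1 : N + α < N * p) (hp2 : 2 * τ + p * ((N : ℝ) - 4) < N + α) :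
    ∃ M : ℝ, 0 < M ∧ ∀ u : EuclideanSpace ℝ (Fin N) → ℂ,
      ContDiff ℝ (⊤ : ℕ∞) u → HasCompactSupport u → l2norm u = 1 → l2norm (lap u) = 1 →
      hartreeP α τ p u ≤ M := by
  have hN' : (5 : ℝ) ≤ N := by exact_mod_cast hN
  have hN0 : (0 : ℝ) < N := by linarith
  have hp : 0 < p := by
    by_contra hh
    nlinarith
  have hpN : 0 < p * ((N : ℝ) - 4) := mul_pos hp (by linarith)
  set D := 2 * τ + p * ((N : ℝ) - 4) with hD
  have hD0 : 0 < D := by positivity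
  set q₀ : ℝ := 2 * N / (N + α) with hq0
  have hq0' : q₀ * (N + α) = 2 * N := by rw [hq0]; field_simp
  have a1 : 1 < q₀ := by rw [hq0, lt_div_iff₀ (by linarith)]; linarith
  have a2 : 2 / p < q₀ := by
    rw [hq0, div_lt_div_iff₀ hp (by linarith)]; nlinarith
  have a3 : q₀ < 2 := by rw [hq0, div_lt_iff₀ (by linarith)]; linarith
  have a4 : q₀ < 2 * N / D := by
    rw [hq0]; exact div_lt_div_of_pos_left (by linarith) hD0 hp2
  obtain ⟨q₁, b1, b2⟩ := exists_between (lt_min a3 a4)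
  obtain ⟨q₂, b3, b4⟩ := exists_between (max_lt a1 a2)
  rw [lt_min_iff] at b2
  rw [max_lt_iff] at b3
  have cond : ∀ q, 1 < q → q < 2 → 2 / p < q → q < 2 * N / D → 1 < q ∧ 2 < p * q ∧ q * D < 2 * N ∧
      1 < q / (2 * q - 2) ∧ 2 / q + 1 / (q / (2 * q - 2)) = 2 := by
    intro q h1 h2 h3 h4
    refine ⟨h1, ?_, ?_, ?_, ?_⟩
    · rw [div_lt_iff₀ hp] at h3; linarith
    · rwa [lt_div_iff₀ hD0] at h4
    · rw [lt_div_iff₀ (by linarith)]; linarith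
    · have : q ≠ 0 := by linarith
      have : 2 * q - 2 ≠ 0 := by linarith
      field_simp; ring
  obtain ⟨c1, c2, c3, c4, c5⟩ := cond q₁ (by linarith) b2.1 (by linarith) b2.2
  obtain ⟨d1, d2, d3, d4, d5⟩ := cond q₂ b3.1 (by linarith) b3.2 (by linarith)
  have near := aux_near (N := N) (by omega) ((α - N) * (q₁ / (2 * q₁ - 2))) (by
    have : (N - α) * (q₁ / (2 * q₁ - 2)) < N := by
      rw [mul_div_assoc', div_lt_iff₀ (by linarith)]; nlinarith
    linarith)
  have far := aux_far (N := N) (by omega) ((α - N) * (q₂ / (2 * q₂ - 2))) (by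
    have : N < (N - α) * (q₂ / (2 * q₂ - 2)) := by
      rw [mul_div_assoc', lt_div_iff₀ (by linarith)]; nlinarith
    linarith)
  obtain ⟨C, hC⟩ := sobolev hN
  have c4' : ((2 * N / (N - 4) : ℝ≥0) : ℝ) = 2 * (N : ℝ) / (N - 4) := by
    rw [NNReal.coe_div, NNReal.coe_sub (by rw [← NNReal.coe_le_coe]; push_cast; linarith)]; simp
  set S : ℝ≥0∞ := (C : ℝ≥0∞) ^ (2 * N / (N - 4) : ℝ) with hS
  have hr0 : (0 : ℝ) < 2 * N / (N - 4) := div_pos (by linarith) (by linarith)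
  have hSf : S < ∞ := ENNReal.rpow_lt_top_of_nonneg hr0.le ENNReal.coe_ne_top
  obtain ⟨M₁, hM1, H1⟩ := weight_bound hN τ p q₁ hτ hp c1 c2 c3 S hSf
  obtain ⟨M₂, hM2, H2⟩ := weight_bound hN τ p q₂ hτ hp d1 d2 d3 S hSf
  set I₁ := ∫⁻ x : EuclideanSpace ℝ (Fin N), ENNReal.ofReal ((Set.Iio (1 : ℝ)).indicator
    (fun r => r ^ ((α - N) * (q₁ / (2 * q₁ - 2)))) ‖x‖) with hI1
  set I₂ := ∫⁻ x : EuclideanSpace ℝ (Fin N), ENNReal.ofReal ((Set.Ici (1 : ℝ)).indicator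
    (fun r => r ^ ((α - N) * (q₂ / (2 * q₂ - 2)))) ‖x‖) with hI2
  set T : ℝ≥0∞ := ENNReal.ofReal |rieszConst N α| * ((M₁ * M₁ + M₁ * I₁ + M₁ * I₁) +
    (M₂ * M₂ + M₂ * I₂ + M₂ * I₂)) with hT
  have hTf : T ≠ ∞ := by
    have := hM1.ne; have := hM2.ne; have := near.ne; have := far.ne
    rw [hT]
    finiteness
  refine ⟨T.toReal + 1, by positivity, fun u hu h l1 l2 => ?_⟩
  have hg : Measurable fun x => ‖u x‖ₑ := hu.continuous.measurable.enorm
  have hf : Measurable fun x : EuclideanSpace ℝ (Fin N) => ENNReal.ofReal (‖x‖ ^ (-τ)) * ‖u x‖ₑ ^ p :=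
    (measurable_norm.pow_const _).ennreal_ofReal.mul (hg.pow_const _)
  have i1 : ∫⁻ x, ‖u x‖ₑ ^ (2 : ℝ) ≤ 1 := by
    have := (eLp_two hu.continuous h).le
    rw [l1, eLpNorm_eq_lintegral_rpow_enorm_toReal (by simp) (by simp), ENNReal.toReal_ofNat,
      ENNReal.ofReal_one] at this
    rw [one_div, ENNReal.rpow_inv_le_iff (by norm_num), ENNReal.one_rpow] at this
    exact this
  have i2 : ∫⁻ x, ‖u x‖ₑ ^ (2 * N / (N - 4) : ℝ) ≤ S := by
    have := hC u hu h
    rw [l2, ENNReal.ofReal_one, mul_one, eLpNorm_eq_lintegral_rpow_enorm_toReal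
      (by
        intro h0
        rw [ENNReal.coe_eq_zero] at h0
        rw [h0] at c4'
        rw [← c4', NNReal.coe_zero] at hr0
        exact lt_irrefl _ hr0) (by simp), ENNReal.coe_toReal, c4', one_div, ENNReal.rpow_inv_le_iff hr0] at this
    exact this
  have := (hartree_le α τ p u hp).trans (mul_le_mul_right (kernel_split _ hf (α - N) q₁ q₂ _ _ c1 d1 c4 d4 c5 d5
    M₁ M₂ (H1 _ hg i1 i2) (H2 _ hg i1 i2)) _)
  have := (ENNReal.ofReal_le_iff_le_toReal hTf).1 this
  linarith

lemma scale_l2 {N : ℕ} (c l : ℝ) (hc : 0 < c) (hl : 0 < l) (u : EuclideanSpace ℝ (Fin N) → ℂ) :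
    l2norm (fun x => c • u (l • x)) = c * l ^ (-((N : ℝ) / 2)) * l2norm u := by
  have h0 : 0 ≤ ∫ x, ‖u x‖ ^ 2 := integral_nonneg fun x => by positivity
  have : ∫ x, ‖c • u (l • x)‖ ^ 2 = c ^ 2 * l ^ (-(N : ℝ)) * ∫ x, ‖u x‖ ^ 2 := by
    have e : ∀ x, ‖c • u (l • x)‖ ^ 2 = c ^ 2 * ‖u (l • x)‖ ^ 2 := by
      intro x; rw [norm_smul, mul_pow, Real.norm_of_nonneg hc.le]
    simp_rw [e]
    rw [integral_const_mul, Measure.integral_comp_smul volume (fun x => ‖u x‖ ^ 2) l,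
      abs_of_pos (by positivity), Real.rpow_neg hl.le, Real.rpow_natCast, smul_eq_mul]
    simp [mul_assoc]
  rw [l2norm, this, Real.mul_rpow (by positivity) h0, Real.mul_rpow (by positivity) (by positivity),
    ← Real.rpow_natCast c, ← Real.rpow_mul hc.le, ← Real.rpow_mul hl.le, l2norm]
  have e1 : ((2 : ℕ) : ℝ) * (1 / 2) = 1 := by norm_num
  have e2 : -(N : ℝ) * (1 / 2) = -((N : ℝ) / 2) := by ring
  rw [e1, e2, Real.rpow_one]

lemma scale_pd {N : ℕ} (c l : ℝ) (u : EuclideanSpace ℝ (Fin N) → ℂ) (i : Fin N) :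
    pd i (fun x => c • u (l • x)) = fun x => (c * l) • pd i u (l • x) := by
  ext1 x
  have h1 : fderiv ℝ (fun x => c • u (l • x)) x = c • fderiv ℝ (fun x => u (l • x)) x := by
    exact congrFun (fderiv_const_smul_field (f := fun x => u (l • x)) c) x
  rw [pd, h1, fderiv_comp_smul]
  simp [pd, mul_assoc]

lemma scale_lap {N : ℕ} (c l : ℝ) (u : EuclideanSpace ℝ (Fin N) → ℂ) :
    lap (fun x => c • u (l • x)) = fun x => (c * l * l) • lap u (l • x) := by
  ext1 x
  rw [lap_eq, lap_eq, Finset.smul_sum]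
  refine Finset.sum_congr rfl fun i _ => ?_
  rw [scale_pd, scale_pd]

lemma scale_P {N : ℕ} (α τ p c l : ℝ) (hc : 0 < c) (hl : 0 < l)
    (u : EuclideanSpace ℝ (Fin N) → ℂ) :
    hartreeP α τ p (fun x => c • u (l • x)) =
      c ^ (2 * p) * l ^ (2 * τ - α - N) * hartreeP α τ p u := by
  have hn : ∀ x : EuclideanSpace ℝ (Fin N), ‖x‖ = l⁻¹ * ‖l • x‖ := by
    intro x; rw [norm_smul, Real.norm_of_nonneg hl.le]; field_simp
  have hnt : ∀ (x : EuclideanSpace ℝ (Fin N)) (t : ℝ), ‖x‖ ^ t = l ^ (-t) * ‖l • x‖ ^ t := by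
    intro x t
    rw [norm_smul, Real.norm_of_nonneg hl.le, Real.mul_rpow hl.le (norm_nonneg _), ← mul_assoc,
      ← Real.rpow_add hl]; simp
  have hcu : ∀ z : ℂ, ‖c • z‖ ^ p = c ^ p * ‖z‖ ^ p := by
    intro z
    rw [norm_smul, Real.norm_of_nonneg hc.le, Real.mul_rpow hc.le (norm_nonneg _)]
  have conv : ∀ x, rieszConvR α (fun y => ‖y‖ ^ (-τ) * ‖c • u (l • y)‖ ^ p) x =
      l ^ (τ - α) * c ^ p * rieszConvR α (fun y => ‖y‖ ^ (-τ) * ‖u y‖ ^ p) (l • x) := by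
    intro x
    have e : ∀ y, rieszConst N α * ‖x - y‖ ^ (α - (N : ℝ)) * (‖y‖ ^ (-τ) * ‖c • u (l • y)‖ ^ p) =
        (l ^ (N - α + τ) * c ^ p) * (fun y => rieszConst N α * ‖l • x - y‖ ^ (α - (N : ℝ)) *
          (‖y‖ ^ (-τ) * ‖u y‖ ^ p)) (l • y) := by
      intro y
      rw [hnt (x - y), hnt y, hcu, smul_sub, Real.rpow_add hl, neg_neg, neg_sub]
      ring
    rw [rieszConvR]
    simp_rw [e]
    rw [integral_const_mul, Measure.integral_comp_smul volume
      (fun y => rieszConst N α * ‖l • x - y‖ ^ (α - (N : ℝ)) * (‖y‖ ^ (-τ) * ‖u y‖ ^ p)) l, abs_of_pos (by positivity), smul_eq_mul,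
      rieszConvR]
    have e2 : l ^ (τ - α) = l ^ (N - α + τ) * (l ^ N)⁻¹ := by
      rw [← Real.rpow_natCast l N, ← Real.rpow_neg hl.le, ← Real.rpow_add hl]
      congr 1; ring
    rw [e2]
    simp
    ring
  rw [hartreeP]
  simp_rw [conv]
  have e : ∀ x, ‖x‖ ^ (-τ) * (l ^ (τ - α) * c ^ p *
        rieszConvR α (fun y => ‖y‖ ^ (-τ) * ‖u y‖ ^ p) (l • x)) * ‖c • u (l • x)‖ ^ p =
      (l ^ τ * l ^ (τ - α) * (c ^ p * c ^ p)) * (fun x => ‖x‖ ^ (-τ) *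
        rieszConvR α (fun y => ‖y‖ ^ (-τ) * ‖u y‖ ^ p) x * ‖u x‖ ^ p) (l • x) := by
    intro x
    rw [hnt x, hcu, neg_neg]
    ring
  simp_rw [e]
  rw [integral_const_mul, Measure.integral_comp_smul volume
      (fun x => ‖x‖ ^ (-τ) * rieszConvR α (fun y => ‖y‖ ^ (-τ) * ‖u y‖ ^ p) x * ‖u x‖ ^ p) l, abs_of_pos (by positivity), smul_eq_mul,
    hartreeP]
  have e2 : l ^ (2 * τ - α - N) = l ^ τ * l ^ (τ - α) * (l ^ N)⁻¹ := by
    rw [← Real.rpow_natCast l N, ← Real.rpow_neg hl.le, ← Real.rpow_add hl, ← Real.rpow_add hl]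
    congr 1; ring
  have e3 : c ^ (2 * p) = c ^ p * c ^ p := by
    rw [← Real.rpow_add hc]; congr 1; ring
  rw [e2, e3]
  simp
  ring

lemma l2_nonneg {N : ℕ} (u : EuclideanSpace ℝ (Fin N) → ℂ) : 0 ≤ l2norm u :=
  Real.rpow_nonneg (integral_nonneg fun x => by positivity) _

lemma zero_of_eLp {N : ℕ} {u : EuclideanSpace ℝ (Fin N) → ℂ} (hu : Continuous u) (r : ℝ≥0∞)
    (hr : r ≠ 0) (h : eLpNorm u r volume = 0) : u = 0 := by
  rw [eLpNorm_eq_zero_iff hu.aestronglyMeasurable hr] at h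
  exact Continuous.ae_eq_iff_eq volume hu continuous_zero |>.1 h

lemma hartree_zero {N : ℕ} (α τ p : ℝ) (hp : 0 < p) :
    hartreeP α τ p (0 : EuclideanSpace ℝ (Fin N) → ℂ) = 0 := by
  simp [hartreeP, Real.zero_rpow hp.ne']

theorem gn_hartree_biharmonic (N : ℕ) (hN : 5 ≤ N) (α τ p B A : ℝ)
    (hα : 0 < α) (hαN : α < N) (hτ : 0 < 2 * τ)
    (hτ1 : 2 * τ < N + α) (hτ2 : 2 * τ < 4 * (1 + α / N))
    (hp1 : 1 + α / N < p) (hp2 : p < 1 + (4 - 2 * τ + α) / ((N : ℝ) - 4))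
    (hB : B = (N * p - N - α + 2 * τ) / 2) (hA : A = 2 * p - B) :
    ∃ C > 0, ∀ u : EuclideanSpace ℝ (Fin N) → ℂ,
      ContDiff ℝ (⊤ : ℕ∞) u → HasCompactSupport u →
      hartreeP α τ p u ≤ C * l2norm u ^ A * l2norm (lap u) ^ B := by
  have hN' : (5 : ℝ) ≤ N := by exact_mod_cast hN
  have hN0 : (0 : ℝ) < N := by linarith
  have hN4 : (0 : ℝ) < N - 4 := by linarith
  have hp : 0 < p := lt_trans (by positivity) hp1
  have k1 : N + α < N * p := by
    have := mul_lt_mul_of_pos_left hp1 hN0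
    rwa [mul_add, mul_one, mul_div_cancel₀ _ hN0.ne'] at this
  have k2 : 2 * τ + p * ((N : ℝ) - 4) < N + α := by
    have := mul_lt_mul_of_pos_right hp2 hN4
    rw [add_mul, div_mul_cancel₀ _ hN4.ne'] at this
    linarith
  obtain ⟨M, hM, H⟩ := normalized hN α τ p hα hαN (by linarith) k1 k2
  refine ⟨M, hM, fun u hu h => ?_⟩
  have a0 := l2_nonneg u
  have b0 := l2_nonneg (lap u)
  have triv : u = 0 → hartreeP α τ p u ≤ M * l2norm u ^ A * l2norm (lap u) ^ B := by
    intro hu0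
    have : hartreeP α τ p u = 0 := by rw [hu0]; exact hartree_zero α τ p hp
    rw [this]
    positivity
  rcases a0.eq_or_lt with ha | ha
  · refine triv (zero_of_eLp hu.continuous 2 (by simp) ?_)
    rw [eLp_two hu.continuous h, ← ha]; simp
  rcases b0.eq_or_lt with hb | hb
  · obtain ⟨C, hC⟩ := sobolev hN
    have := hC u hu h
    rw [← hb] at this
    refine triv (zero_of_eLp hu.continuous _ ?_ (le_antisymm (this.trans (by simp)) zero_le))
    have : (0 : ℝ≥0) < N - 4 := by
      rw [tsub_pos_iff_lt]; exact_mod_cast hN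
    rw [Ne, ENNReal.coe_eq_zero]
    have : (0 : ℝ≥0) < N := by exact_mod_cast (by omega : 0 < N)
    positivity
  set a := l2norm u with haa
  set b := l2norm (lap u) with hbb
  set l := (a / b) ^ ((1 : ℝ) / 2) with hl
  have hl0 : 0 < l := by positivity
  have hll : l * l = a / b := by
    rw [hl, ← Real.rpow_add (by positivity)]; norm_num
  set c := l ^ ((N : ℝ) / 2) / a with hc
  have hc0 : 0 < c := by positivity
  have hln : l ^ ((N : ℝ) / 2) * l ^ (-((N : ℝ) / 2)) = 1 := by
    rw [← Real.rpow_add hl0]; simp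
  have n1 : l2norm (fun x => c • u (l • x)) = 1 := by
    rw [scale_l2 c l hc0 hl0, ← haa, hc]
    field_simp
    exact hln
  have n2 : l2norm (lap (fun x => c • u (l • x))) = 1 := by
    rw [scale_lap, scale_l2 (c * l * l) l (by positivity) hl0, ← hbb, mul_assoc c, hll, hc]
    field_simp
    exact hln
  have sm : ContDiff ℝ (⊤ : ℕ∞) (fun x => c • u (l • x)) :=
    (hu.comp (contDiff_const_smul l)).const_smul c
  have cs : HasCompactSupport (fun x => c • u (l • x)) := by
    have := h.comp_homeomorph (Homeomorph.smulOfNeZero l hl0.ne')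
    exact this.smul_left (f := fun _ => c)
  have fin := H _ sm cs n1 n2
  rw [scale_P α τ p c l hc0 hl0] at fin
  have key : a ^ A * b ^ B * (c ^ (2 * p) * l ^ (2 * τ - α - N)) = 1 := by
    have e1 : c ^ (2 * p) = l ^ (N * p) * a ^ (-(2 * p)) := by
      rw [hc, Real.div_rpow (by positivity) ha.le, ← Real.rpow_mul hl0.le, Real.rpow_neg ha.le,
        div_eq_mul_inv]
      congr 2; ring
    have e2 : l ^ (N * p) * l ^ (2 * τ - α - N) = a ^ B * b ^ (-B) := by
      rw [← Real.rpow_add hl0, hl, ← Real.rpow_mul (by positivity), Real.rpow_neg hb.le,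
        ← div_eq_mul_inv, ← Real.div_rpow ha.le hb.le]
      congr 1; rw [hB]; ring
    calc a ^ A * b ^ B * (c ^ (2 * p) * l ^ (2 * τ - α - N))
        = a ^ A * b ^ B * a ^ (-(2 * p)) * (l ^ (N * p) * l ^ (2 * τ - α - N)) := by rw [e1]; ring
      _ = (a ^ A * a ^ (-(2 * p)) * a ^ B) * (b ^ B * b ^ (-B)) := by rw [e2]; ring
      _ = 1 := by
        rw [← Real.rpow_add ha, ← Real.rpow_add ha, ← Real.rpow_add hb, hA]
        have z : 2 * p - B + -(2 * p) + B = 0 := by ring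
        rw [z]; simp
  calc hartreeP α τ p u = (a ^ A * b ^ B) * (c ^ (2 * p) * l ^ (2 * τ - α - N) * hartreeP α τ p u) := by
        rw [← mul_assoc, key, one_mul]
    _ ≤ (a ^ A * b ^ B) * M := by gcongr
    _ = _ := by ring
end

section
/- (Gagliardo–Nirenberg inequality for the inhomogeneous local nonlinearity, inverse-square potential case.) Let N ≥ 3, λ > −(N−2)²/4, 0 < τ < 1, and 1 < q < 1 + (2 − 2τ)/(N−2). Set B' := Nq − N + 2τ and A' := 2q − B'. Then there exists a constant C > 0 such that for every smooth compactly supported v : ℝ^N → ℂ, Q[v] ≤ C ‖v‖^{A'} (‖√K_λ v‖²)^{B'/2}. -/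
open MeasureTheory

noncomputable def gradNormSq {N : ℕ} (u : EuclideanSpace ℝ (Fin N) → ℂ)
    (x : EuclideanSpace ℝ (Fin N)) : ℝ :=
  ∑ i, ‖fderiv ℝ u x (EuclideanSpace.single i 1)‖ ^ 2

/-- The quantity `‖√K_λ u‖²`. -/
noncomputable def kineticK {N : ℕ} (lam : ℝ) (u : EuclideanSpace ℝ (Fin N) → ℂ) : ℝ :=
  (∫ x, gradNormSq u x) + lam * ∫ x, ‖u x‖ ^ 2 / ‖x‖ ^ 2

/-- The weighted potential energy `Q[v] = ∫ |x|^{-2τ} |v(x)|^{2q} dx`. -/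
noncomputable def potQ {N : ℕ} (τ q : ℝ) (v : EuclideanSpace ℝ (Fin N) → ℂ) : ℝ :=
  ∫ x, ‖x‖ ^ (-(2 * τ)) * ‖v x‖ ^ (2 * q)

lemma aux_opnorm {N : ℕ} (u : (EuclideanSpace ℝ (Fin N)) → ℂ) (x : EuclideanSpace ℝ (Fin N)) :
    ‖fderiv ℝ u x‖ ^ 2 ≤ gradNormSq u x := by
  have h0 : 0 ≤ gradNormSq u x := Finset.sum_nonneg fun i _ => by positivity
  have : ‖fderiv ℝ u x‖ ≤ Real.sqrt (gradNormSq u x) := by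
    refine ContinuousLinearMap.opNorm_le_bound _ (Real.sqrt_nonneg _) fun y => ?_
    have hy : y = ∑ i, y i • (EuclideanSpace.single i (1:ℝ) : EuclideanSpace ℝ (Fin N)) := by
      have := (EuclideanSpace.basisFun (Fin N) ℝ).sum_repr y
      simpa using this.symm
    have h1 : ‖fderiv ℝ u x y‖ ≤ ∑ i, ‖fderiv ℝ u x (EuclideanSpace.single i 1)‖ * ‖y i‖ := by
      conv_lhs => rw [hy]
      rw [map_sum]
      refine (norm_sum_le _ _).trans (Finset.sum_le_sum fun i _ => ?_)
      rw [map_smul, norm_smul, mul_comm]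
    refine h1.trans ((Real.sum_mul_le_sqrt_mul_sqrt _ _ _).trans ?_)
    rw [EuclideanSpace.norm_eq]
    rfl
  calc _ ≤ Real.sqrt (gradNormSq u x) ^ 2 := by gcongr
    _ = _ := Real.sq_sqrt h0

lemma gradNormSq_cont {N : ℕ} {u : (EuclideanSpace ℝ (Fin N)) → ℂ} (hu : ContDiff ℝ (⊤ : ℕ∞) u) :
    Continuous (gradNormSq u) := by
  have := hu.continuous_fderiv (by simp)
  unfold gradNormSq
  fun_prop

lemma gradNormSq_supp {N : ℕ} {u : (EuclideanSpace ℝ (Fin N)) → ℂ} (hc : HasCompactSupport u) :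
    HasCompactSupport (gradNormSq u) := by
  have := hc.fderiv (𝕜 := ℝ)
  refine this.mono' ?_
  intro x hx
  apply subset_tsupport
  intro h
  apply hx
  simp [gradNormSq, h]

lemma integral_deriv_zero {N : ℕ} {f : (EuclideanSpace ℝ (Fin N)) → ℝ} (hf : ContDiff ℝ 1 f)
    (hc : HasCompactSupport f) (w : EuclideanSpace ℝ (Fin N)) : ∫ x, fderiv ℝ f x w = 0 := by
  have := integral_mul_fderiv_eq_neg_fderiv_mul_of_integrable (𝕜 := ℝ) (μ := (volume : Measure (EuclideanSpace ℝ (Fin N))))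
    (f := fun _ => (1:ℝ)) (g := f) (v := w)
  simp at this
  apply this
  · have h1 : Continuous fun x => fderiv ℝ f x w := by
      have := hf.continuous_fderiv (by simp)
      fun_prop
    exact h1.integrable_of_hasCompactSupport (hc.fderiv_apply (𝕜 := ℝ) w)
  · exact hf.continuous.integrable_of_hasCompactSupport hc
  · exact fun x _ => hf.differentiable (by simp) x

/-- pointwise computation -/
lemma hardy_deriv {N : ℕ} {u : (EuclideanSpace ℝ (Fin N)) → ℂ} (hu : ContDiff ℝ (⊤ : ℕ∞) u) {ε : ℝ} (hε : 0 < ε)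
    (x : EuclideanSpace ℝ (Fin N)) (i : Fin N) :
    fderiv ℝ (fun y : EuclideanSpace ℝ (Fin N) => (y i / (‖y‖ ^ 2 + ε)) * ‖u y‖ ^ 2) x (EuclideanSpace.single i 1)
      = (x i / (‖x‖ ^ 2 + ε)) * (2 * inner ℝ (u x) (fderiv ℝ u x (EuclideanSpace.single i 1)))
        + (1 / (‖x‖ ^ 2 + ε) - 2 * (x i) ^ 2 / (‖x‖ ^ 2 + ε) ^ 2) * ‖u x‖ ^ 2 := by
  have hne : ‖x‖ ^ 2 + ε ≠ 0 := by positivity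
  have h1 : HasFDerivAt (fun y : EuclideanSpace ℝ (Fin N) => y i) (EuclideanSpace.proj i : (EuclideanSpace ℝ (Fin N)) →L[ℝ] ℝ) x :=
    (EuclideanSpace.proj i : (EuclideanSpace ℝ (Fin N)) →L[ℝ] ℝ).hasFDerivAt
  have h2 := ((hasStrictFDerivAt_norm_sq x).hasFDerivAt).add_const ε
  have h3 := ((hu.differentiable (by simp)) x).hasFDerivAt.norm_sq
  have h5 := (hasDerivAt_inv hne).comp_hasFDerivAt x h2
  have h4 := (h1.fun_mul h5).fun_mul h3
  have h6 : (fun y : EuclideanSpace ℝ (Fin N) => (y i / (‖y‖ ^ 2 + ε)) * ‖u y‖ ^ 2)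
    = fun y => (y i * ((fun y => y⁻¹) ∘ fun y => ‖y‖ ^ 2 + ε) y) * ‖u y‖ ^ 2 := by
    ext y; simp [div_eq_mul_inv]
  rw [h6, h4.fderiv]
  simp [EuclideanSpace.inner_single_right]
  field_simp
  ring

lemma hardy_pointwise {N : ℕ} (u : (EuclideanSpace ℝ (Fin N)) → ℂ) {ε : ℝ} (hε : 0 < ε) (hN : 3 ≤ N)
    (x : EuclideanSpace ℝ (Fin N)) :
    (((N : ℝ) - 2) / 2) ^ 2 * (‖u x‖ ^ 2 / (‖x‖ ^ 2 + ε)) ≤ gradNormSq u x +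
      (((N : ℝ) - 2) / 2) * ∑ i,
      ((x i / (‖x‖ ^ 2 + ε)) * (2 * inner ℝ (u x) (fderiv ℝ u x (EuclideanSpace.single i 1)))
        + (1 / (‖x‖ ^ 2 + ε) - 2 * (x i) ^ 2 / (‖x‖ ^ 2 + ε) ^ 2) * ‖u x‖ ^ 2) := by
  set α : ℝ := ((N : ℝ) - 2) / 2 with hα
  have hα0 : 0 < α := by
    have : (3:ℝ) ≤ N := by exact_mod_cast hN
    rw [hα]; linarith
  have hN' : (N : ℝ) = 2 * α + 2 := by rw [hα]; ring
  set D := ‖x‖ ^ 2 + ε with hD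
  have hD0 : 0 < D := by positivity
  have hx : ∑ i, (x i) ^ 2 = ‖x‖ ^ 2 := by
    rw [EuclideanSpace.norm_sq_eq]; simp
  have key : ∀ i, 0 ≤ ‖fderiv ℝ u x (EuclideanSpace.single i 1)‖ ^ 2
      + α * ((x i / D) * (2 * inner ℝ (u x) (fderiv ℝ u x (EuclideanSpace.single i 1))))
      + α ^ 2 * ((x i) ^ 2 * (‖u x‖ ^ 2 / D ^ 2)) := by
    intro i
    have h := sq_nonneg ‖fderiv ℝ u x (EuclideanSpace.single i 1) + (α * (x i / D)) • u x‖
    rw [norm_add_sq_real, inner_smul_right, norm_smul, mul_pow, Real.norm_eq_abs, sq_abs,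
      real_inner_comm] at h
    calc _ ≤ _ := h
      _ = _ := by field_simp
  have hs := Finset.sum_nonneg fun i (_ : i ∈ Finset.univ) => key i
  rw [Finset.sum_add_distrib, Finset.sum_add_distrib, ← Finset.mul_sum, ← Finset.mul_sum,
    ← Finset.sum_mul, hx] at hs
  rw [Finset.sum_add_distrib, ← Finset.sum_mul, Finset.sum_sub_distrib, ← Finset.sum_div _ _ (D ^ 2),
    ← Finset.mul_sum, hx]
  simp only [Finset.sum_const, Finset.card_univ, Fintype.card_fin, nsmul_eq_mul]
  rw [hN']
  change 0 ≤ gradNormSq u x + _ + _ at hs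
  have hxD : ‖x‖ ^ 2 = D - ε := by rw [hD]; ring
  rw [hxD] at hs ⊢
  have e1 : (2 * α + 2) * (1 / D) - 2 * (D - ε) / D ^ 2 = 2 * α / D + 2 * ε / D ^ 2 := by
    field_simp; ring
  have e2 : α ^ 2 * ((D - ε) * (‖u x‖ ^ 2 / D ^ 2)) =
      α ^ 2 * (‖u x‖ ^ 2 / D) - α ^ 2 * ε * (‖u x‖ ^ 2 / D ^ 2) := by
    field_simp
  rw [e1, mul_add]
  rw [e2] at hs
  have e3 : α * ((2 * α / D + 2 * ε / D ^ 2) * ‖u x‖ ^ 2) =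
     2 * (α ^ 2 * (‖u x‖ ^ 2 / D)) + 2 * α * ε * (‖u x‖ ^ 2 / D ^ 2) := by
    field_simp
  rw [e3]
  have : 0 ≤ 2 * α * ε * (‖u x‖ ^ 2 / D ^ 2) := by positivity
  have : 0 ≤ α ^ 2 * ε * (‖u x‖ ^ 2 / D ^ 2) := by positivity
  linarith

lemma hardy_eps {N : ℕ} {u : (EuclideanSpace ℝ (Fin N)) → ℂ} (hu : ContDiff ℝ (⊤ : ℕ∞) u)
    (hc : HasCompactSupport u) {ε : ℝ} (hε : 0 < ε) (hN : 3 ≤ N) :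
    (((N : ℝ) - 2) / 2) ^ 2 * ∫ x, (‖u x‖ ^ 2 / (‖x‖ ^ 2 + ε)) ≤ ∫ x, gradNormSq u x := by
  have hsm : ∀ i : Fin N, ContDiff ℝ 1 (fun y : EuclideanSpace ℝ (Fin N) => (y i / (‖y‖ ^ 2 + ε)) * ‖u y‖ ^ 2) := by
    intro i
    refine ContDiff.mul (ContDiff.div ?_ ?_ ?_) ?_
    · exact (EuclideanSpace.proj i : (EuclideanSpace ℝ (Fin N)) →L[ℝ] ℝ).contDiff
    · exact (contDiff_norm_sq ℝ).add contDiff_const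
    · intro y; positivity
    · exact (hu.of_le (by simp)).norm_sq ℝ
  have hcs : ∀ i : Fin N, HasCompactSupport
      (fun y : EuclideanSpace ℝ (Fin N) => (y i / (‖y‖ ^ 2 + ε)) * ‖u y‖ ^ 2) := by
    intro i
    refine hc.mono ?_
    intro x hx h
    apply hx
    simp [h]
  have hint : ∀ i : Fin N, Integrable (fun x => fderiv ℝ
      (fun y : EuclideanSpace ℝ (Fin N) => (y i / (‖y‖ ^ 2 + ε)) * ‖u y‖ ^ 2) x (EuclideanSpace.single i 1)) := by
    intro i
    have h1 := (hsm i).continuous_fderiv (by simp)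
    have h2 : Continuous (fun x => fderiv ℝ
      (fun y : EuclideanSpace ℝ (Fin N) => (y i / (‖y‖ ^ 2 + ε)) * ‖u y‖ ^ 2) x (EuclideanSpace.single i 1)) := by
      fun_prop
    exact h2.integrable_of_hasCompactSupport ((hcs i).fderiv_apply (𝕜 := ℝ) _)
  have hG : Integrable (gradNormSq u) :=
    (gradNormSq_cont hu).integrable_of_hasCompactSupport (gradNormSq_supp hc)
  have hL : Integrable (fun x : EuclideanSpace ℝ (Fin N) => ‖u x‖ ^ 2 / (‖x‖ ^ 2 + ε)) := by
    have hcu := hu.continuous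
    refine Continuous.integrable_of_hasCompactSupport ?_ ?_
    · refine Continuous.div (by fun_prop) (by fun_prop) fun y => by positivity
    · refine hc.mono ?_
      intro x hx h
      apply hx
      simp [h]
  have hsum : ∫ x, ∑ i : Fin N, fderiv ℝ
      (fun y : EuclideanSpace ℝ (Fin N) => (y i / (‖y‖ ^ 2 + ε)) * ‖u y‖ ^ 2) x (EuclideanSpace.single i 1) = 0 := by
    rw [integral_finsetSum _ fun i _ => hint i]
    exact Finset.sum_eq_zero fun i _ => integral_deriv_zero (hsm i) (hcs i) _
  have hI : Integrable (fun x => ∑ i : Fin N, fderiv ℝ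
      (fun y : EuclideanSpace ℝ (Fin N) => (y i / (‖y‖ ^ 2 + ε)) * ‖u y‖ ^ 2) x (EuclideanSpace.single i 1)) :=
    integrable_finsetSum _ fun i _ => hint i
  calc _ = ∫ x, (((N : ℝ) - 2) / 2) ^ 2 * (‖u x‖ ^ 2 / (‖x‖ ^ 2 + ε)) :=
        (integral_const_mul _ _).symm
    _ ≤ ∫ x, (gradNormSq u x + (((N : ℝ) - 2) / 2) * ∑ i : Fin N, fderiv ℝ
      (fun y : EuclideanSpace ℝ (Fin N) => (y i / (‖y‖ ^ 2 + ε)) * ‖u y‖ ^ 2) x (EuclideanSpace.single i 1)) := by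
        refine integral_mono (hL.const_mul _) (hG.add (hI.const_mul _)) fun x => ?_
        have := hardy_pointwise u hε hN x
        simp only [hardy_deriv hu hε]
        exact this
    _ = _ := by
        rw [integral_add hG (hI.const_mul _), integral_const_mul, hsum]; simp

lemma hardy_lintegral {N : ℕ} {u : (EuclideanSpace ℝ (Fin N)) → ℂ} (hu : ContDiff ℝ (⊤ : ℕ∞) u)
    (hc : HasCompactSupport u) (hN : 3 ≤ N) :
    ∫⁻ x, ENNReal.ofReal (‖u x‖ ^ 2 / ‖x‖ ^ 2) ≤
      ENNReal.ofReal ((∫ x, gradNormSq u x) / (((N : ℝ) - 2) / 2) ^ 2) := by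
  have hα0 : 0 < ((N : ℝ) - 2) / 2 := by
    have : (3:ℝ) ≤ N := by exact_mod_cast hN
    linarith
  have hcu := hu.continuous
  have hcont : ∀ n : ℕ, Continuous (fun x : EuclideanSpace ℝ (Fin N) => ‖u x‖ ^ 2 / (‖x‖ ^ 2 + 1 / ((n : ℝ) + 1))) :=
    fun n => Continuous.div (by fun_prop) (by fun_prop) fun y => by positivity
  have hb : ∀ n : ℕ, ∫⁻ x, ENNReal.ofReal (‖u x‖ ^ 2 / (‖x‖ ^ 2 + 1 / ((n : ℝ) + 1))) ≤
      ENNReal.ofReal ((∫ x, gradNormSq u x) / (((N : ℝ) - 2) / 2) ^ 2) := by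
    intro n
    rw [← ofReal_integral_eq_lintegral_ofReal]
    · apply ENNReal.ofReal_le_ofReal
      rw [le_div_iff₀ (by positivity), mul_comm]
      exact hardy_eps hu hc (by positivity) hN
    · refine (hcont n).integrable_of_hasCompactSupport (hc.mono ?_)
      intro x hx h
      apply hx
      simp [h]
    · exact Filter.Eventually.of_forall fun x => by positivity
  have hne : ∀ᵐ x : EuclideanSpace ℝ (Fin N), x ≠ 0 := by
    have : Nonempty (Fin N) := ⟨⟨0, by omega⟩⟩
    have : Nontrivial (EuclideanSpace ℝ (Fin N)) := inferInstance
    exact Measure.ae_ne volume 0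
  calc _ = ∫⁻ x, Filter.liminf (fun n : ℕ =>
        ENNReal.ofReal (‖u x‖ ^ 2 / (‖x‖ ^ 2 + 1 / ((n : ℝ) + 1)))) Filter.atTop := by
        refine lintegral_congr_ae ?_
        filter_upwards [hne] with x hx
        refine (Filter.Tendsto.liminf_eq ?_).symm
        refine ENNReal.tendsto_ofReal ?_
        refine Filter.Tendsto.div tendsto_const_nhds ?_ (by positivity)
        simpa using tendsto_const_nhds.add (tendsto_one_div_add_atTop_nhds_zero_nat (𝕜 := ℝ))
    _ ≤ _ := lintegral_liminf_le fun n => (hcont n).measurable.ennreal_ofReal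
    _ ≤ _ := by
        refine Filter.liminf_le_of_le (by isBoundedDefault) fun b hb' => ?_
        obtain ⟨n, hn⟩ := hb'.exists
        exact hn.trans (hb n)

lemma hardy_integrable {N : ℕ} {u : (EuclideanSpace ℝ (Fin N)) → ℂ} (hu : ContDiff ℝ (⊤ : ℕ∞) u)
    (hc : HasCompactSupport u) (hN : 3 ≤ N) :
    ∫ x, ‖u x‖ ^ 2 / ‖x‖ ^ 2 ≤ (∫ x, gradNormSq u x) / (((N : ℝ) - 2) / 2) ^ 2 := by
  have hG0 : 0 ≤ ∫ x, gradNormSq u x :=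
    integral_nonneg fun x => Finset.sum_nonneg fun i _ => by positivity
  have hcu := hu.continuous
  rw [integral_eq_lintegral_of_nonneg_ae]
  · refine ENNReal.toReal_le_of_le_ofReal (by positivity) (hardy_lintegral hu hc hN)
  · exact Filter.Eventually.of_forall fun x => by positivity
  · exact (Measurable.div (by fun_prop) (by fun_prop)).aestronglyMeasurable

lemma kinetic_bound {N : ℕ} (hN : 3 ≤ N) {lam : ℝ} (hlam : -(((N : ℝ) - 2) ^ 2 / 4) < lam) :
    ∃ c > 0, ∀ u : (EuclideanSpace ℝ (Fin N)) → ℂ, ContDiff ℝ (⊤ : ℕ∞) u → HasCompactSupport u →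
      ∫ x, gradNormSq u x ≤ c * kineticK lam u := by
  have hα0 : 0 < ((N : ℝ) - 2) := by
    have : (3:ℝ) ≤ N := by exact_mod_cast hN
    linarith
  have hH0 : ∀ u : (EuclideanSpace ℝ (Fin N)) → ℂ, 0 ≤ ∫ x, ‖u x‖ ^ 2 / ‖x‖ ^ 2 :=
    fun u => integral_nonneg fun x => by positivity
  rcases le_or_gt 0 lam with h | h
  · refine ⟨1, one_pos, fun u hu hc => ?_⟩
    have := mul_nonneg h (hH0 u)
    unfold kineticK
    linarith
  · have hd : 0 < 1 + lam / (((N : ℝ) - 2) / 2) ^ 2 := by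
      have : -1 < lam / (((N : ℝ) - 2) / 2) ^ 2 := by
        rw [lt_div_iff₀ (by positivity)]; linarith
      linarith
    refine ⟨(1 + lam / (((N : ℝ) - 2) / 2) ^ 2)⁻¹, by positivity, fun u hu hc => ?_⟩
    have h1 := mul_le_mul_of_nonpos_left (hardy_integrable hu hc hN) h.le
    rw [inv_mul_eq_div, le_div_iff₀ hd]
    unfold kineticK
    calc _ = (∫ x, gradNormSq u x) + lam * ((∫ x, gradNormSq u x) / (((N : ℝ) - 2) / 2) ^ 2) := by
          ring
      _ ≤ _ := by linarith

lemma sobolev_bound {N : ℕ} (hN : 3 ≤ N) :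
    ∃ S > 0, ∀ u : (EuclideanSpace ℝ (Fin N)) → ℂ, ContDiff ℝ (⊤ : ℕ∞) u → HasCompactSupport u →
      ∫⁻ x, ENNReal.ofReal (‖u x‖ ^ (2 * N / ((N : ℝ) - 2))) ≤
        ENNReal.ofReal (S * (∫ x, gradNormSq u x) ^ (N / ((N : ℝ) - 2))) := by
  have hN3 : (3:ℝ) ≤ N := by exact_mod_cast hN
  have hα0 : 0 < ((N : ℝ) - 2) := by linarith
  set p' : NNReal := ⟨2 * N / ((N : ℝ) - 2), by positivity⟩ with hp'
  have hp'c : (p' : ℝ) = 2 * N / ((N : ℝ) - 2) := rfl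
  have hp'0 : (0:ℝ) < p' := by rw [hp'c]; positivity
  set C : NNReal := SNormLESNormFDerivOfEqConst ℂ (volume : Measure (EuclideanSpace ℝ (Fin N))) (2 : NNReal) with hC
  refine ⟨((C : ℝ) + 1) ^ (p' : ℝ), by positivity, fun u hu hc => ?_⟩
  have hG0 : 0 ≤ ∫ x, gradNormSq u x :=
    integral_nonneg fun x => Finset.sum_nonneg fun i _ => by positivity
  have h := eLpNorm_le_eLpNorm_fderiv_of_eq (volume : Measure (EuclideanSpace ℝ (Fin N))) (hu.of_le (by simp)) hc
    (p := 2) (p' := p') (by norm_num) (by simp; omega)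
    (by rw [hp'c]; simp; field_simp)
  have h2 : eLpNorm (fderiv ℝ u) (2 : NNReal) volume ≤
      ENNReal.ofReal ((∫ x, gradNormSq u x) ^ (1 / 2 : ℝ)) := by
    rw [eLpNorm_nnreal_eq_lintegral (by norm_num)]
    rw [← ENNReal.ofReal_rpow_of_nonneg hG0 (by norm_num)]
    simp only [NNReal.coe_ofNat]
    gcongr
    rw [ofReal_integral_eq_lintegral_ofReal]
    · refine lintegral_mono fun x => ?_
      rw [← ofReal_norm, ENNReal.ofReal_rpow_of_nonneg (norm_nonneg _) (by norm_num)]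
      refine ENNReal.ofReal_le_ofReal ?_
      exact_mod_cast aux_opnorm u x
    · exact (gradNormSq_cont hu).integrable_of_hasCompactSupport (gradNormSq_supp hc)
    · exact Filter.Eventually.of_forall fun x => Finset.sum_nonneg fun i _ => by positivity
  have h3 : eLpNorm u p' volume ≤ ENNReal.ofReal (((C : ℝ) + 1) *
      (∫ x, gradNormSq u x) ^ (1 / 2 : ℝ)) := by
    rw [ENNReal.ofReal_mul (by positivity)]
    refine h.trans (mul_le_mul' ?_ h2)
    rw [← hC, ← ENNReal.ofReal_coe_nnreal]
    exact ENNReal.ofReal_le_ofReal (by linarith)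
  rw [eLpNorm_nnreal_eq_lintegral (by exact_mod_cast hp'0.ne')] at h3
  rw [one_div (p' : ℝ), ENNReal.rpow_inv_le_iff hp'0,
    ENNReal.ofReal_rpow_of_nonneg (by positivity) hp'0.le,
    Real.mul_rpow (by positivity) (by positivity), ← Real.rpow_mul hG0] at h3
  have e : 1 / 2 * (p' : ℝ) = N / ((N : ℝ) - 2) := by rw [hp'c]; field_simp
  rw [e] at h3
  refine le_trans (le_of_eq ?_) h3
  refine lintegral_congr fun x => ?_
  rw [← ofReal_norm, ENNReal.ofReal_rpow_of_nonneg (norm_nonneg _) hp'0.le]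
  rfl

lemma holder_three {N : ℕ} {v : (EuclideanSpace ℝ (Fin N)) → ℂ} (hv : Continuous v) {τ q a b p : ℝ}
    (hτ : 0 < τ) (ha : 0 < a) (hb : 0 < b) (hp : 0 < p) (h1 : τ + a + b = 1)
    (h2 : 2 * τ + 2 * a + p * b = 2 * q) :
    ∫⁻ x, ENNReal.ofReal (‖x‖ ^ (-(2 * τ)) * ‖v x‖ ^ (2 * q)) ≤
      (∫⁻ x, ENNReal.ofReal (‖v x‖ ^ 2 / ‖x‖ ^ 2)) ^ τ *
      (∫⁻ x, ENNReal.ofReal (‖v x‖ ^ 2)) ^ a * (∫⁻ x, ENNReal.ofReal (‖v x‖ ^ p)) ^ b := by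
  have H := ENNReal.lintegral_prod_norm_pow_le (μ := (volume : Measure (EuclideanSpace ℝ (Fin N))))
    (Finset.univ : Finset (Fin 3))
    (f := ![fun x => ENNReal.ofReal (‖v x‖ ^ 2 / ‖x‖ ^ 2), fun x => ENNReal.ofReal (‖v x‖ ^ 2),
      fun x => ENNReal.ofReal (‖v x‖ ^ p)]) (p := ![τ, a, b]) ?_ ?_ ?_
  · simp only [Fin.prod_univ_three, Matrix.cons_val] at H
    refine le_trans (le_of_eq (lintegral_congr fun x => ?_)) H
    rw [ENNReal.ofReal_rpow_of_nonneg (by positivity) hτ.le,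
      ENNReal.ofReal_rpow_of_nonneg (by positivity) ha.le,
      ENNReal.ofReal_rpow_of_nonneg (by positivity) hb.le, ← ENNReal.ofReal_mul (by positivity),
      ← ENNReal.ofReal_mul (by positivity)]
    congr 1
    rw [Real.div_rpow (by positivity) (by positivity), ← Real.rpow_natCast, ← Real.rpow_natCast,
      ← Real.rpow_mul (norm_nonneg _), ← Real.rpow_mul (norm_nonneg _),
      ← Real.rpow_mul (norm_nonneg _), ← Real.rpow_mul (norm_nonneg _),
      Real.rpow_neg (norm_nonneg _), div_mul_eq_mul_div, div_mul_eq_mul_div,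
      ← Real.rpow_add_of_nonneg (norm_nonneg _) (by positivity) (by positivity),
      ← Real.rpow_add_of_nonneg (norm_nonneg _) (by positivity) (by positivity)]
    push_cast
    rw [h2, inv_mul_eq_div]
  · intro i _
    fin_cases i
    · exact (Measurable.div (by fun_prop) (by fun_prop) :
        Measurable fun x : EuclideanSpace ℝ (Fin N) => ‖v x‖ ^ 2 / ‖x‖ ^ 2).ennreal_ofReal.aemeasurable
    · exact (by fun_prop : Measurable fun x : EuclideanSpace ℝ (Fin N) => ‖v x‖ ^ 2).ennreal_ofReal.aemeasurable
    · exact (by fun_prop : Measurable fun x : EuclideanSpace ℝ (Fin N) => ‖v x‖ ^ p).ennreal_ofReal.aemeasurable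
  · simpa [Fin.sum_univ_three] using h1
  · intro i _
    fin_cases i
    · exact hτ.le
    · exact ha.le
    · exact hb.le

/-- **Gagliardo–Nirenberg inequality for the inhomogeneous local nonlinearity,
inverse-square potential case.** -/
theorem gn_local_inverse_square (N : ℕ) (hN : 3 ≤ N) (τ lam q B' A' : ℝ)
    (hlam : -(((N : ℝ) - 2) ^ 2 / 4) < lam)
    (hτ0 : 0 < τ) (hτ1 : τ < 1)
    (hq1 : 1 < q) (hq2 : q < 1 + (2 - 2 * τ) / ((N : ℝ) - 2))
    (hB : B' = N * q - N + 2 * τ) (hA : A' = 2 * q - B') :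
    ∃ C > 0, ∀ v : EuclideanSpace ℝ (Fin N) → ℂ,
      ContDiff ℝ (⊤ : ℕ∞) v → HasCompactSupport v →
      potQ τ q v ≤ C * l2norm v ^ A' * kineticK lam v ^ (B' / 2) := by
  have hN3 : (3:ℝ) ≤ N := by exact_mod_cast hN
  have hα0 : 0 < ((N : ℝ) - 2) := by linarith
  obtain ⟨c, hc0, hc⟩ := kinetic_bound hN hlam
  obtain ⟨S, hS0, hS⟩ := sobolev_bound hN
  set b : ℝ := (q - 1) * ((N : ℝ) - 2) / 2 with hb
  set a : ℝ := 1 - τ - b with ha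
  set β : ℝ := (((N : ℝ) - 2) / 2) ^ 2 with hβ
  have hβ0 : 0 < β := by positivity
  have hb0 : 0 < b := by
    have : 0 < q - 1 := by linarith
    positivity
  have ha0 : 0 < a := by
    have : (q - 1) * ((N : ℝ) - 2) < 2 - 2 * τ := by
      rw [← lt_div_iff₀ hα0]; linarith
    rw [ha, hb]; linarith
  have hB0 : 0 < B' / 2 := by
    have : 0 < (N : ℝ) * (q - 1) := mul_pos (by linarith) (by linarith)
    rw [hB]; linarith
  have hexp : τ + N / ((N : ℝ) - 2) * b = B' / 2 := by
    rw [hB, hb]; field_simp; ring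
  refine ⟨β⁻¹ ^ τ * S ^ b * c ^ (B' / 2), by positivity, fun v hv hcv => ?_⟩
  set G := ∫ x, gradNormSq v x with hG
  have hG0 : 0 ≤ G :=
    integral_nonneg fun x => Finset.sum_nonneg fun i _ => by positivity
  set m := ∫ x, ‖v x‖ ^ 2 with hm
  have hm0 : 0 ≤ m := integral_nonneg fun x => by positivity
  have hcont := hv.continuous
  have hK0 : 0 ≤ kineticK lam v := by
    have := hG0.trans (hc v hv hcv)
    exact nonneg_of_mul_nonneg_right this hc0
  have hM : ∫⁻ x, ENNReal.ofReal (‖v x‖ ^ 2) = ENNReal.ofReal m := by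
    rw [hm, ofReal_integral_eq_lintegral_ofReal]
    · refine Continuous.integrable_of_hasCompactSupport (by fun_prop) (hcv.mono ?_)
      intro x hx h
      apply hx
      simp [h]
    · exact Filter.Eventually.of_forall fun x => by positivity
  have hQ : potQ τ q v ≤ (G / β) ^ τ * m ^ a * (S * G ^ (N / ((N : ℝ) - 2))) ^ b := by
    unfold potQ
    rw [integral_eq_lintegral_of_nonneg_ae]
    · refine ENNReal.toReal_le_of_le_ofReal (by positivity) ?_
      refine (holder_three (a := a) (b := b) (p := 2 * N / ((N : ℝ) - 2)) hcont hτ0 ha0 hb0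
        (by positivity) (by rw [ha]; ring) (by rw [ha, hb]; field_simp; ring)).trans ?_
      rw [ENNReal.ofReal_mul (by positivity), ENNReal.ofReal_mul (by positivity),
        ← ENNReal.ofReal_rpow_of_nonneg (by positivity) hτ0.le,
        ← ENNReal.ofReal_rpow_of_nonneg (by positivity) ha0.le,
        ← ENNReal.ofReal_rpow_of_nonneg (by positivity) hb0.le, hM]
      gcongr
      · exact hardy_lintegral hv hcv hN
      · exact hS v hv hcv
    · exact Filter.Eventually.of_forall fun x => by positivity
    · exact (by fun_prop : Measurable fun x : EuclideanSpace ℝ (Fin N) =>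
        ‖x‖ ^ (-(2 * τ)) * ‖v x‖ ^ (2 * q)).aestronglyMeasurable
  have hl2 : l2norm v ^ A' = m ^ a := by
    unfold l2norm
    rw [← hm, ← Real.rpow_mul hm0]
    congr 1
    rw [hA, hB, ha, hb]; ring
  have hGK : G ^ (B' / 2) ≤ c ^ (B' / 2) * kineticK lam v ^ (B' / 2) := by
    rw [← Real.mul_rpow hc0.le hK0]
    exact Real.rpow_le_rpow hG0 (hc v hv hcv) hB0.le
  calc potQ τ q v ≤ _ := hQ
    _ = (β⁻¹ ^ τ * S ^ b * m ^ a) * G ^ (B' / 2) := by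
      rw [div_eq_mul_inv, Real.mul_rpow hG0 (by positivity), Real.mul_rpow hS0.le (by positivity),
        ← Real.rpow_mul hG0, ← hexp, Real.rpow_add_of_nonneg hG0 hτ0.le (by positivity)]
      ring
    _ ≤ (β⁻¹ ^ τ * S ^ b * m ^ a) * (c ^ (B' / 2) * kineticK lam v ^ (B' / 2)) := by
      gcongr
    _ = _ := by rw [hl2]; ring
end
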